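/- Assume Ω is nonempty and there exists x₁ ∈ [0, A] with x₁² < P and ℰ(x₁) > E_req. Then the (unique) capacity-achieving input distribution F* — the maximizer of I over Ω — is discrete with a finite number of mass points; that is, the topological support of F* is a finite subset of [0, A]. -/

import Mathlib

open MeasureTheory Real Set Filter

/-- Phase-removed Rayleigh-fading channel density `p(y|x)`. -/
noncomputable def pcond (x y : ℝ) : ℝ := (1 / (1 + x ^ 2)) * Real.exp (-y / (1 + x ^ 2))

/-- Modified Bessel function of the first kind, order zero. -/
noncomputable def besselI0 (t : ℝ) : ℝ := ∑' n : ℕ, (t ^ 2 / 4) ^ n / ((Nat.factorial n : ℝ)) ^ 2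

/-- Harvested-energy function `ℰ(x) = I₀(√2 B h₂ x)`. -/
noncomputable def EH (B h2 x : ℝ) : ℝ := besselI0 (Real.sqrt 2 * B * h2 * x)

/-- Output density `p(y; F)`. -/
noncomputable def pout (F : Measure ℝ) (y : ℝ) : ℝ := ∫ x, pcond x y ∂F

/-- Mutual-information density `i(x; F)`. -/
noncomputable def idens (F : Measure ℝ) (x : ℝ) : ℝ :=
  ∫ y in Set.Ioi (0 : ℝ), pcond x y * Real.log (pcond x y / pout F y)

/-- Mutual information `I(F)`. -/
noncomputable def MI (F : Measure ℝ) : ℝ := ∫ x, idens F x ∂F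

/-- Borel probability measure concentrated on `[0, A]`. -/
def IsDistOn (A : ℝ) (F : Measure ℝ) : Prop :=
  IsProbabilityMeasure F ∧ F (Set.Icc 0 A)ᶜ = 0

/-- The feasible set `Ω`: probability measures on `[0,A]` meeting the AP and EH constraints. -/
def Feas (A P B h2 Ereq : ℝ) (F : Measure ℝ) : Prop :=
  IsDistOn A F ∧ (∫ x, x ^ 2 ∂F) ≤ P ∧ Ereq ≤ ∫ x, EH B h2 x ∂F

/-- Information-energy capacity `C = sup_{F ∈ Ω} I(F)`. -/
noncomputable def Cap (A P B h2 Ereq : ℝ) : ℝ :=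
  sSup (MI '' {F | Feas A P B h2 Ereq F})

/-- Topological support of a measure: points all of whose open neighborhoods have
positive measure (the smallest closed set of full measure). -/
def msupp {X : Type*} [TopologicalSpace X] [MeasurableSpace X] (μ : Measure X) : Set X :=
  {x | ∀ U : Set X, IsOpen U → x ∈ U → 0 < μ U}

/-- The entire function `u ↦ ∑ uⁿ / (n!)²`, with `I₀(t) = besselSeries (t² / 4)`. -/
noncomputable def besselSeries (u : ℝ) : ℝ := ∑' n : ℕ, u ^ n / ((Nat.factorial n : ℝ)) ^ 2

lemma summable_besselSeries (u : ℝ) :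
    Summable fun n : ℕ => u ^ n / ((Nat.factorial n : ℝ)) ^ 2 := by
  refine Summable.of_norm_bounded (Real.summable_pow_div_factorial |u|) fun n => ?_
  have h1 : (1 : ℝ) ≤ Nat.factorial n := by exact_mod_cast Nat.one_le_iff_ne_zero.2 n.factorial_ne_zero
  rw [norm_div, norm_pow, norm_pow, Real.norm_eq_abs, Real.norm_of_nonneg (by positivity)]
  gcongr
  nlinarith

lemma analyticOnNhd_besselSeries : AnalyticOnNhd ℝ besselSeries univ := by
  have hr : (FormalMultilinearSeries.ofScalars ℝ
      (fun n : ℕ => (1 : ℝ) / ((Nat.factorial n : ℝ)) ^ 2)).radius = ⊤ := by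
    refine FormalMultilinearSeries.radius_eq_top_of_summable_norm _ fun r => ?_
    refine (summable_besselSeries (r : ℝ)).of_norm_bounded fun n => ?_
    rw [FormalMultilinearSeries.ofScalars_norm, norm_mul, norm_norm, norm_pow, norm_div, norm_pow]
    simp only [norm_one, Real.norm_natCast, NNReal.norm_eq]
    exact le_of_eq (by ring)
  have h := (FormalMultilinearSeries.ofScalars ℝ
      (fun n : ℕ => (1 : ℝ) / ((Nat.factorial n : ℝ)) ^ 2)).hasFPowerSeriesOnBall (by rw [hr]; simp)
  have he : FormalMultilinearSeries.sum (FormalMultilinearSeries.ofScalars ℝ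
      (fun n : ℕ => (1 : ℝ) / ((Nat.factorial n : ℝ)) ^ 2)) = besselSeries := by
    ext u
    change FormalMultilinearSeries.ofScalarsSum _ u = _
    rw [FormalMultilinearSeries.ofScalars_sum_eq, besselSeries]
    exact tsum_congr fun n => by rw [smul_eq_mul]; ring
  rw [he, hr] at h
  simpa using h.analyticOnNhd

lemma sq_div_four_le_besselSeries {u : ℝ} (hu : 0 ≤ u) : u ^ 2 / 4 ≤ besselSeries u := by
  have h := (summable_besselSeries u).le_tsum 2 fun n _ => by positivity
  norm_num at h
  exact h

lemma EH_eq_besselSeries (B h2 x : ℝ) :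
    EH B h2 x = besselSeries (B ^ 2 * h2 ^ 2 / 2 * x ^ 2) := by
  have h : (√2 * B * h2 * x) ^ 2 / 4 = B ^ 2 * h2 ^ 2 / 2 * x ^ 2 := by
    rw [mul_pow, mul_pow, mul_pow, Real.sq_sqrt zero_le_two]; ring
  rw [EH, besselI0, h, besselSeries]

lemma continuous_EH (B h2 : ℝ) : Continuous (EH B h2) := by
  have h : EH B h2 = fun x => besselSeries (B ^ 2 * h2 ^ 2 / 2 * x ^ 2) :=
    funext (EH_eq_besselSeries B h2)
  have hc : Continuous besselSeries := continuousOn_univ.1 analyticOnNhd_besselSeries.continuousOn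
  rw [h]
  fun_prop

lemma pcond_pos (x y : ℝ) : 0 < pcond x y := by
  unfold pcond; positivity

lemma pcond_eq (x y : ℝ) :
    pcond x y = (1 / (1 + x ^ 2)) * Real.exp (-(1 / (1 + x ^ 2)) * y) := by
  rw [pcond]; congr 2; ring

lemma continuous_uncurry_pcond : Continuous (Function.uncurry pcond) := by
  have h : ∀ p : ℝ × ℝ, 1 + p.1 ^ 2 ≠ 0 := fun p => by positivity
  unfold Function.uncurry pcond
  fun_prop (disch := exact h)

lemma continuous_pcond (x : ℝ) : Continuous (pcond x) :=
  continuous_uncurry_pcond.comp (Continuous.prodMk_right x)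

lemma continuous_pcond_left (y : ℝ) : Continuous fun x => pcond x y :=
  continuous_uncurry_pcond.comp (Continuous.prodMk_left y)

lemma pcond_le_one (x : ℝ) {y : ℝ} (hy : 0 ≤ y) : pcond x y ≤ 1 := by
  have h1 : 1 / (1 + x ^ 2) ≤ 1 := by
    rw [div_le_one (by positivity)]; nlinarith [sq_nonneg x]
  have h2 : Real.exp (-y / (1 + x ^ 2)) ≤ 1 := by
    rw [Real.exp_le_one_iff, neg_div]; simp only [Left.neg_nonpos_iff]; positivity
  exact mul_le_one₀ h1 (Real.exp_pos _).le h2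

lemma le_pcond {A x y : ℝ} (hx : x ∈ Icc (0 : ℝ) A) (hy : 0 ≤ y) :
    (1 / (1 + A ^ 2)) * Real.exp (-y) ≤ pcond x y := by
  have hxA : x ^ 2 ≤ A ^ 2 := pow_le_pow_left₀ hx.1 hx.2 2
  have h : -y ≤ -y / (1 + x ^ 2) := by
    rw [le_div_iff₀ (by positivity)]; nlinarith [mul_nonneg hy (sq_nonneg x)]
  unfold pcond
  gcongr

lemma integrableOn_exp_neg_mul {s : ℝ} (hs : 0 < s) :
    IntegrableOn (fun y => Real.exp (-s * y)) (Ioi 0) :=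
  integrableOn_exp_mul_Ioi (neg_lt_zero.2 hs) 0

lemma integral_exp_neg_mul {s : ℝ} (hs : 0 < s) :
    ∫ y in Ioi (0 : ℝ), Real.exp (-s * y) = 1 / s := by
  rw [integral_exp_mul_Ioi (neg_lt_zero.2 hs)]; simp

lemma integral_id_mul_exp_neg_mul {s : ℝ} (hs : 0 < s) :
    ∫ y in Ioi (0 : ℝ), y * Real.exp (-s * y) = (1 / s) ^ 2 := by
  have h := Real.integral_rpow_mul_exp_neg_mul_Ioi (a := 2) two_pos hs
  rw [show (2 : ℝ) - 1 = 1 by norm_num] at h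
  simp only [Real.rpow_one, ← neg_mul] at h
  rw [h, Real.Gamma_two, mul_one]
  norm_cast

lemma integrableOn_id_mul_exp_neg_mul {s : ℝ} (hs : 0 < s) :
    IntegrableOn (fun y => y * Real.exp (-s * y)) (Ioi 0) := by
  refine not_imp_comm.1 integral_undef ?_
  rw [integral_id_mul_exp_neg_mul hs]
  positivity

/-- Integrability of `e^{-sy} g(y)` for `g` of at most linear growth. -/
lemma integrableOn_exp_neg_mul_mul {g : ℝ → ℝ} (hg : Measurable g) {D : ℝ}
    (hb : ∀ y, 0 ≤ y → |g y| ≤ y + D) {s : ℝ} (hs : 0 < s) :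
    IntegrableOn (fun y => Real.exp (-s * y) * g y) (Ioi 0) := by
  refine ((integrableOn_id_mul_exp_neg_mul hs).add
    ((integrableOn_exp_neg_mul hs).const_mul D)).mono' (by fun_prop) ?_
  refine (ae_restrict_mem measurableSet_Ioi).mono fun y hy => ?_
  have h := mul_le_mul_of_nonneg_left (hb y (le_of_lt hy)) (Real.exp_pos (-s * y)).le
  rw [norm_mul, Real.norm_of_nonneg (Real.exp_pos _).le, Real.norm_eq_abs]
  simp only [Pi.add_apply]
  linarith

lemma setIntegral_exp_neg_mul_mul_le {g : ℝ → ℝ} (hg : Measurable g) {D : ℝ}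
    (h0 : ∀ y, 0 ≤ y → 0 ≤ g y) (hb : ∀ y, 0 ≤ y → g y ≤ y + D) {s : ℝ} (hs : 0 < s) :
    ∫ y in Ioi (0 : ℝ), Real.exp (-s * y) * g y ≤ (1 / s) ^ 2 + D * (1 / s) := by
  have hi : IntegrableOn (fun y => Real.exp (-s * y) * g y) (Ioi 0) :=
    integrableOn_exp_neg_mul_mul hg (fun y hy => by rw [abs_of_nonneg (h0 y hy)]; exact hb y hy) hs
  calc ∫ y in Ioi (0 : ℝ), Real.exp (-s * y) * g y
      ≤ ∫ y in Ioi (0 : ℝ), (y * Real.exp (-s * y) + D * Real.exp (-s * y)) := by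
        refine setIntegral_mono_on hi ((integrableOn_id_mul_exp_neg_mul hs).add
          ((integrableOn_exp_neg_mul hs).const_mul D)) measurableSet_Ioi fun y hy => ?_
        have h := mul_le_mul_of_nonneg_left (hb y (le_of_lt hy)) (Real.exp_pos (-s * y)).le
        linarith
    _ = (1 / s) ^ 2 + D * (1 / s) := by
        rw [integral_add (integrableOn_id_mul_exp_neg_mul hs)
          ((integrableOn_exp_neg_mul hs).const_mul D), integral_id_mul_exp_neg_mul hs,
          integral_const_mul, integral_exp_neg_mul hs]

/-- The Laplace transform of a nonnegative function of at most linear growth is real analytic. -/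
lemma analyticOnNhd_laplace {g : ℝ → ℝ} (hg : Measurable g) {D : ℝ}
    (h0 : ∀ y, 0 ≤ y → 0 ≤ g y) (hb : ∀ y, 0 ≤ y → g y ≤ y + D) :
    AnalyticOnNhd ℝ (fun s => ∫ y in Ioi (0 : ℝ), Real.exp (-s * y) * g y) (Ioi 0) := by
  set ν : Measure ℝ := (volume.restrict (Ioi 0)).withDensity fun y => ENNReal.ofReal (g y) with hν
  have hm : Measurable fun y => ENNReal.ofReal (g y) := hg.ennreal_ofReal
  have hgae : ∀ᵐ y ∂volume.restrict (Ioi (0 : ℝ)), (ENNReal.ofReal (g y)).toReal = g y :=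
    (ae_restrict_mem measurableSet_Ioi).mono fun y hy => ENNReal.toReal_ofReal (h0 y (le_of_lt hy))
  have hmgf : ProbabilityTheory.mgf (fun y => -y) ν =
      fun s => ∫ y in Ioi (0 : ℝ), Real.exp (-s * y) * g y := by
    ext s
    rw [ProbabilityTheory.mgf, hν, integral_withDensity_eq_integral_toReal_smul hm
      (ae_of_all _ fun y => ENNReal.ofReal_lt_top)]
    refine integral_congr_ae (hgae.mono fun y hy => ?_)
    simp only [hy, smul_eq_mul]
    rw [mul_comm, mul_neg, neg_mul]
  have hset : Ioi (0 : ℝ) ⊆ ProbabilityTheory.integrableExpSet (fun y => -y) ν := by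
    intro s hs
    have hi := integrableOn_exp_neg_mul_mul hg
      (fun y hy => by rw [abs_of_nonneg (h0 y hy)]; exact hb y hy) (mem_Ioi.1 hs)
    change Integrable _ ν
    rw [hν, integrable_withDensity_iff_integrable_smul' hm
      (ae_of_all _ fun y => ENNReal.ofReal_lt_top)]
    refine hi.congr (hgae.mono fun y hy => ?_)
    simp only [hy, smul_eq_mul]
    rw [mul_comm, mul_neg, neg_mul]
  rw [← hmgf]
  exact ProbabilityTheory.analyticOnNhd_mgf.mono (isOpen_Ioi.subset_interior_iff.2 hset)

lemma integrableOn_pcond (x : ℝ) : IntegrableOn (pcond x) (Ioi 0) := by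
  simp_rw [funext (pcond_eq x)]
  exact (integrableOn_exp_neg_mul (by positivity)).const_mul _

lemma integral_pcond (x : ℝ) : ∫ y in Ioi (0 : ℝ), pcond x y = 1 := by
  simp_rw [pcond_eq]
  rw [integral_const_mul, integral_exp_neg_mul (by positivity)]
  field_simp

namespace IsDistOn

variable {A : ℝ} {F : Measure ℝ}

lemma ae_mem (hF : IsDistOn A F) : ∀ᵐ x ∂F, x ∈ Icc (0 : ℝ) A := by
  rw [ae_iff]; exact hF.2

lemma integrable_of_continuous (hF : IsDistOn A F) {g : ℝ → ℝ} (hg : Continuous g) :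
    Integrable g F := by
  have := hF.1
  obtain ⟨C, hC⟩ := isCompact_Icc.exists_bound_of_continuousOn (s := Icc (0 : ℝ) A) hg.continuousOn
  exact Integrable.of_bound hg.aestronglyMeasurable C (hF.ae_mem.mono hC)

lemma pout_le_one (hF : IsDistOn A F) {y : ℝ} (hy : 0 ≤ y) : pout F y ≤ 1 := by
  have := hF.1
  calc pout F y ≤ ∫ _, (1 : ℝ) ∂F := integral_mono
        (hF.integrable_of_continuous (continuous_pcond_left y)) (integrable_const _)
        fun x => pcond_le_one x hy
    _ = 1 := by simp

lemma le_pout (hF : IsDistOn A F) {y : ℝ} (hy : 0 ≤ y) :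
    (1 / (1 + A ^ 2)) * Real.exp (-y) ≤ pout F y := by
  have := hF.1
  calc (1 / (1 + A ^ 2)) * Real.exp (-y) = ∫ _, (1 / (1 + A ^ 2)) * Real.exp (-y) ∂F := by simp
    _ ≤ pout F y := integral_mono_ae (integrable_const _)
        (hF.integrable_of_continuous (continuous_pcond_left y))
        (hF.ae_mem.mono fun x hx => le_pcond hx hy)

lemma pout_pos (hF : IsDistOn A F) {y : ℝ} (hy : 0 ≤ y) : 0 < pout F y :=
  lt_of_lt_of_le (by positivity) (hF.le_pout hy)

lemma measurable_pout (hF : IsDistOn A F) : Measurable (pout F) := by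
  have := hF.1
  exact (continuous_uncurry_pcond.stronglyMeasurable.integral_prod_left (μ := F)).measurable

lemma neg_log_pout_nonneg (hF : IsDistOn A F) {y : ℝ} (hy : 0 ≤ y) :
    0 ≤ -Real.log (pout F y) :=
  neg_nonneg.2 (Real.log_nonpos (hF.pout_pos hy).le (hF.pout_le_one hy))

lemma neg_log_pout_le (hF : IsDistOn A F) {y : ℝ} (hy : 0 ≤ y) :
    -Real.log (pout F y) ≤ y + Real.log (1 + A ^ 2) := by
  have h := Real.log_le_log (by positivity) (hF.le_pout hy)
  rw [Real.log_mul (by positivity) (Real.exp_pos _).ne', Real.log_exp, one_div, Real.log_inv] at h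
  linarith

lemma integrableOn_exp_mul_neg_log_pout (hF : IsDistOn A F) {s : ℝ} (hs : 0 < s) :
    IntegrableOn (fun y => Real.exp (-s * y) * -Real.log (pout F y)) (Ioi 0) :=
  integrableOn_exp_neg_mul_mul hF.measurable_pout.log.neg
    (fun _ hy => (abs_of_nonneg (hF.neg_log_pout_nonneg hy)).trans_le (hF.neg_log_pout_le hy)) hs

end IsDistOn

/-- Laplace transform of the negative log-density of the output. -/
noncomputable def laplaceOut (F : Measure ℝ) (s : ℝ) : ℝ :=
  ∫ y in Ioi (0 : ℝ), Real.exp (-s * y) * -Real.log (pout F y)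

namespace IsDistOn

variable {A : ℝ} {F : Measure ℝ}

lemma analyticOnNhd_laplaceOut (hF : IsDistOn A F) :
    AnalyticOnNhd ℝ (laplaceOut F) (Ioi 0) :=
  analyticOnNhd_laplace hF.measurable_pout.log.neg (fun _ hy => hF.neg_log_pout_nonneg hy)
    fun _ hy => hF.neg_log_pout_le hy

lemma laplaceOut_nonneg (hF : IsDistOn A F) (s : ℝ) : 0 ≤ laplaceOut F s :=
  setIntegral_nonneg measurableSet_Ioi fun _ hy =>
    mul_nonneg (Real.exp_pos _).le (hF.neg_log_pout_nonneg (le_of_lt hy))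

lemma laplaceOut_le (hF : IsDistOn A F) {s : ℝ} (hs : 0 < s) :
    laplaceOut F s ≤ (1 / s) ^ 2 + Real.log (1 + A ^ 2) * (1 / s) :=
  setIntegral_exp_neg_mul_mul_le hF.measurable_pout.log.neg
    (fun _ hy => hF.neg_log_pout_nonneg hy) (fun _ hy => hF.neg_log_pout_le hy) hs

lemma idens_eq (hF : IsDistOn A F) (x : ℝ) :
    idens F x = -Real.log (1 + x ^ 2) - 1 +
      (1 / (1 + x ^ 2)) * laplaceOut F (1 / (1 + x ^ 2)) := by
  set s := 1 / (1 + x ^ 2) with hs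
  have hs0 : 0 < s := by positivity
  have hlog : -Real.log (1 + x ^ 2) = Real.log s := by rw [hs, one_div, Real.log_inv]
  have h1 := (integrableOn_exp_neg_mul hs0).const_mul (s * Real.log s)
  have h2 := (integrableOn_id_mul_exp_neg_mul hs0).const_mul (s * s)
  have h3 := (hF.integrableOn_exp_mul_neg_log_pout hs0).const_mul s
  have h12 : IntegrableOn (fun y => s * Real.log s * Real.exp (-s * y)
      - s * s * (y * Real.exp (-s * y))) (Ioi 0) := h1.sub h2
  have hcongr : idens F x = ∫ y in Ioi (0 : ℝ), (s * Real.log s * Real.exp (-s * y)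
      - s * s * (y * Real.exp (-s * y)) + s * (Real.exp (-s * y) * -Real.log (pout F y))) := by
    refine setIntegral_congr_fun measurableSet_Ioi fun y hy => ?_
    rw [Real.log_div (pcond_pos x y).ne' (hF.pout_pos (le_of_lt hy)).ne', pcond_eq, ← hs,
      Real.log_mul hs0.ne' (Real.exp_pos _).ne', Real.log_exp]
    ring
  rw [hcongr, integral_add h12 h3, integral_sub h1 h2, integral_const_mul,
    integral_const_mul, integral_const_mul, integral_exp_neg_mul hs0,
    integral_id_mul_exp_neg_mul hs0, hlog, laplaceOut]
  field_simp

lemma continuous_idens (hF : IsDistOn A F) : Continuous (idens F) := by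
  have hx : ∀ x : ℝ, 1 + x ^ 2 ≠ 0 := fun x => by positivity
  have hs : Continuous fun x : ℝ => 1 / (1 + x ^ 2) := by fun_prop (disch := exact hx)
  have hL : Continuous fun x : ℝ => laplaceOut F (1 / (1 + x ^ 2)) :=
    hF.analyticOnNhd_laplaceOut.continuousOn.comp_continuous hs fun x => by
      simp only [mem_Ioi]; positivity
  rw [funext hF.idens_eq]
  exact ((((by fun_prop : Continuous fun x : ℝ => 1 + x ^ 2).log hx).neg).sub
    continuous_const).add (hs.mul hL)

end IsDistOn

/-- The perturbation `(1 + ε r) F` of the measure `F`. -/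
noncomputable def perturb (F : Measure ℝ) (r : ℝ → ℝ) (ε : ℝ) : Measure ℝ :=
  F.withDensity fun x => ENNReal.ofReal (1 + ε * r x)

/-- The density of the signed output measure with input `r F`. -/
noncomputable def poutSigned (F : Measure ℝ) (r : ℝ → ℝ) (y : ℝ) : ℝ := ∫ x, pcond x y * r x ∂F

lemma abs_mul_le_half {M ε t : ℝ} (hε : 0 ≤ ε) (hεM : ε * M ≤ 1 / 2) (ht : |t| ≤ M) :
    |ε * t| ≤ 1 / 2 := by
  rw [abs_mul, abs_of_nonneg hε]
  exact (mul_le_mul_of_nonneg_left ht hε).trans hεM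

namespace IsDistOn

variable {A : ℝ} {F : Measure ℝ} {r : ℝ → ℝ} {M ε : ℝ}

lemma integral_perturb (hr : Measurable r) (hM : ∀ x, |r x| ≤ M)
    (hε : 0 ≤ ε) (hεM : ε * M ≤ 1 / 2) {g : ℝ → ℝ} (hg : Integrable g F) :
    ∫ x, g x ∂perturb F r ε = ∫ x, g x ∂F + ε * ∫ x, g x * r x ∂F := by
  rw [perturb, integral_withDensity_eq_integral_toReal_smul (by fun_prop)
    (ae_of_all _ fun y => ENNReal.ofReal_lt_top)]
  have hgr : Integrable (fun x => g x * r x) F :=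
    hg.mul_bdd hr.aestronglyMeasurable (ae_of_all _ hM)
  rw [← integral_const_mul, ← integral_add hg (hgr.const_mul ε)]
  refine integral_congr_ae (ae_of_all _ fun x => ?_)
  have h := abs_le.1 (abs_mul_le_half hε hεM (hM x))
  simp only [smul_eq_mul]
  rw [ENNReal.toReal_ofReal (by linarith [h.1])]
  ring

lemma perturb_isDistOn (hF : IsDistOn A F) (hr : Measurable r) (hM : ∀ x, |r x| ≤ M)
    (hε : 0 ≤ ε) (hεM : ε * M ≤ 1 / 2) (h0 : ∫ x, r x ∂F = 0) : IsDistOn A (perturb F r ε) := by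
  have := hF.1
  refine ⟨⟨?_⟩, withDensity_absolutelyContinuous _ _ hF.2⟩
  have hint : Integrable (fun x => 1 + ε * r x) F :=
    (integrable_const _).add ((Integrable.of_bound hr.aestronglyMeasurable M
      (ae_of_all _ hM)).const_mul ε)
  rw [perturb, withDensity_apply _ MeasurableSet.univ, setLIntegral_univ,
    ← ofReal_integral_eq_lintegral_ofReal hint (ae_of_all _ fun x => by
      have h := abs_le.1 (abs_mul_le_half hε hεM (hM x))
      simp only [Pi.zero_apply]
      linarith [h.1]),
    integral_add (integrable_const _) ((Integrable.of_bound hr.aestronglyMeasurable M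
      (ae_of_all _ hM)).const_mul ε), integral_const_mul, h0]
  simp

lemma pout_perturb (hF : IsDistOn A F) (hr : Measurable r) (hM : ∀ x, |r x| ≤ M)
    (hε : 0 ≤ ε) (hεM : ε * M ≤ 1 / 2) (y : ℝ) :
    pout (perturb F r ε) y = pout F y + ε * poutSigned F r y :=
  integral_perturb hr hM hε hεM (hF.integrable_of_continuous (continuous_pcond_left y))

lemma measurable_poutSigned (hF : IsDistOn A F) (hr : Measurable r) :
    Measurable (poutSigned F r) := by
  have := hF.1
  have h : StronglyMeasurable (Function.uncurry fun x y => pcond x y * r x) :=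
    (continuous_uncurry_pcond.measurable.mul (hr.comp measurable_fst)).stronglyMeasurable
  exact (h.integral_prod_left (μ := F)).measurable

lemma abs_poutSigned_le (hF : IsDistOn A F) (hM : ∀ x, |r x| ≤ M) (y : ℝ) :
    |poutSigned F r y| ≤ M * pout F y := by
  rw [poutSigned, pout, ← integral_const_mul, ← Real.norm_eq_abs]
  refine norm_integral_le_of_norm_le
    ((hF.integrable_of_continuous (continuous_pcond_left y)).const_mul M) (ae_of_all _ fun x => ?_)
  rw [norm_mul, Real.norm_of_nonneg (pcond_pos x y).le, mul_comm]
  exact mul_le_mul_of_nonneg_right (hM x) (pcond_pos x y).le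

end IsDistOn

/-- The relative output perturbation `∫ p(y|x) r(x) dF(x) / p(y; F)`. -/
noncomputable def relOut (F : Measure ℝ) (r : ℝ → ℝ) (y : ℝ) : ℝ := poutSigned F r y / pout F y

/-- The conditional mean of `relOut F r` given the input `x`. -/
noncomputable def relMean (F : Measure ℝ) (r : ℝ → ℝ) (x : ℝ) : ℝ :=
  ∫ y in Ioi (0 : ℝ), pcond x y * relOut F r y

lemma pout_nonneg (F : Measure ℝ) (y : ℝ) : 0 ≤ pout F y :=
  integral_nonneg fun x => (pcond_pos x y).le

lemma integrable_uncurry_pcond (F : Measure ℝ) [IsFiniteMeasure F] :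
    Integrable (Function.uncurry pcond) (F.prod (volume.restrict (Ioi 0))) := by
  rw [integrable_prod_iff continuous_uncurry_pcond.aestronglyMeasurable]
  refine ⟨ae_of_all _ fun x => integrableOn_pcond x, ?_⟩
  refine (integrable_const (1 : ℝ)).congr (ae_of_all _ fun x => ?_)
  simp only [Function.uncurry_apply_pair]
  rw [← integral_pcond x]
  exact integral_congr_ae (ae_of_all _ fun y => (Real.norm_of_nonneg (pcond_pos x y).le).symm)

namespace IsDistOn

variable {A : ℝ} {F : Measure ℝ} {r : ℝ → ℝ} {M ε : ℝ}

lemma abs_relOut_le (hF : IsDistOn A F) (hM : ∀ x, |r x| ≤ M) (y : ℝ) : |relOut F r y| ≤ M := by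
  have hM0 : 0 ≤ M := (abs_nonneg _).trans (hM 0)
  rw [relOut, abs_div, abs_of_nonneg (pout_nonneg F y)]
  exact div_le_of_le_mul₀ (pout_nonneg F y) hM0 (hF.abs_poutSigned_le hM y)

lemma measurable_relOut (hF : IsDistOn A F) (hr : Measurable r) : Measurable (relOut F r) :=
  (hF.measurable_poutSigned hr).div hF.measurable_pout

lemma integrableOn_pcond_mul_relOut (hF : IsDistOn A F) (hr : Measurable r)
    (hM : ∀ x, |r x| ≤ M) (x : ℝ) : IntegrableOn (fun y => pcond x y * relOut F r y) (Ioi 0) :=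
  (integrableOn_pcond x).mul_bdd (hF.measurable_relOut hr).aestronglyMeasurable
    (ae_of_all _ (hF.abs_relOut_le hM))

lemma abs_relMean_le (hF : IsDistOn A F) (hM : ∀ x, |r x| ≤ M) (x : ℝ) : |relMean F r x| ≤ M := by
  have h : ‖relMean F r x‖ ≤ ∫ y in Ioi (0 : ℝ), M * pcond x y := by
    refine norm_integral_le_of_norm_le ((integrableOn_pcond x).const_mul M)
      (ae_of_all _ fun y => ?_)
    rw [norm_mul, Real.norm_of_nonneg (pcond_pos x y).le, mul_comm]
    exact mul_le_mul_of_nonneg_right (hF.abs_relOut_le hM y) (pcond_pos x y).le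
  rwa [integral_const_mul, integral_pcond, mul_one] at h

lemma measurable_relMean (hF : IsDistOn A F) (hr : Measurable r) : Measurable (relMean F r) := by
  have h : StronglyMeasurable (Function.uncurry fun x y => pcond x y * relOut F r y) :=
    (continuous_uncurry_pcond.measurable.mul
      ((hF.measurable_relOut hr).comp measurable_snd)).stronglyMeasurable
  exact h.integral_prod_right.measurable

lemma integral_relMean (hF : IsDistOn A F) (hr : Measurable r) (hM : ∀ x, |r x| ≤ M) :
    ∫ x, relMean F r x ∂F = ∫ x, r x ∂F := by
  have := hF.1
  have hi := integrable_uncurry_pcond F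
  have h1 : Integrable (Function.uncurry fun x y => pcond x y * relOut F r y)
      (F.prod (volume.restrict (Ioi 0))) :=
    hi.mul_bdd ((hF.measurable_relOut hr).comp measurable_snd).aestronglyMeasurable
      (ae_of_all _ fun p => hF.abs_relOut_le hM p.2)
  have h2 : Integrable (Function.uncurry fun x y => pcond x y * r x)
      (F.prod (volume.restrict (Ioi 0))) :=
    hi.mul_bdd (hr.comp measurable_fst).aestronglyMeasurable (ae_of_all _ fun p => hM p.1)
  calc ∫ x, relMean F r x ∂F
      = ∫ y in Ioi (0 : ℝ), ∫ x, pcond x y * relOut F r y ∂F := integral_integral_swap h1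
    _ = ∫ y in Ioi (0 : ℝ), ∫ x, pcond x y * r x ∂F := by
        refine setIntegral_congr_fun measurableSet_Ioi fun y hy => ?_
        rw [integral_mul_const]
        exact mul_div_cancel₀ (poutSigned F r y) (hF.pout_pos (le_of_lt hy)).ne'
    _ = ∫ x, (∫ y in Ioi (0 : ℝ), pcond x y * r x) ∂F := (integral_integral_swap h2).symm
    _ = ∫ x, r x ∂F := by
        refine integral_congr_ae (ae_of_all _ fun x => ?_)
        simp only
        rw [integral_mul_const, integral_pcond, one_mul]

lemma idens_perturb_ge (hF : IsDistOn A F) (hr : Measurable r) (hM : ∀ x, |r x| ≤ M)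
    (hε : 0 ≤ ε) (hεM : ε * M ≤ 1 / 2) (h0 : ∫ x, r x ∂F = 0) (x : ℝ) :
    idens F x - ε * relMean F r x ≤ idens (perturb F r ε) x := by
  have hG := hF.perturb_isDistOn hr hM hε hεM h0
  have hs0 : 0 < 1 / (1 + x ^ 2) := by positivity
  have hrel : (1 / (1 + x ^ 2)) * laplaceOut F (1 / (1 + x ^ 2)) - ε * relMean F r x =
      ∫ y in Ioi (0 : ℝ), ((1 / (1 + x ^ 2)) *
        (Real.exp (-(1 / (1 + x ^ 2)) * y) * -Real.log (pout F y))
        - ε * (pcond x y * relOut F r y)) := by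
    rw [integral_sub ((hF.integrableOn_exp_mul_neg_log_pout hs0).const_mul _)
      ((hF.integrableOn_pcond_mul_relOut hr hM x).const_mul ε), integral_const_mul,
      integral_const_mul]
    rfl
  have hmain : (1 / (1 + x ^ 2)) * laplaceOut F (1 / (1 + x ^ 2)) - ε * relMean F r x ≤
      (1 / (1 + x ^ 2)) * laplaceOut (perturb F r ε) (1 / (1 + x ^ 2)) := by
    rw [hrel, laplaceOut, ← integral_const_mul]
    refine setIntegral_mono_on (((hF.integrableOn_exp_mul_neg_log_pout hs0).const_mul _).sub
      ((hF.integrableOn_pcond_mul_relOut hr hM x).const_mul ε))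
      ((hG.integrableOn_exp_mul_neg_log_pout hs0).const_mul _) measurableSet_Ioi fun y hy => ?_
    have hp := hF.pout_pos (le_of_lt hy)
    have hpG := hG.pout_pos (le_of_lt hy)
    have hratio : pout (perturb F r ε) y / pout F y - 1 = ε * relOut F r y := by
      rw [hF.pout_perturb hr hM hε hεM, relOut]
      field_simp
      ring
    have hlog := Real.log_le_sub_one_of_pos (div_pos hpG hp)
    rw [Real.log_div hpG.ne' hp.ne', hratio] at hlog
    have hmul := mul_le_mul_of_nonneg_left hlog (pcond_pos x y).le
    have hp_mul : ∀ t : ℝ, 1 / (1 + x ^ 2) * (Real.exp (-(1 / (1 + x ^ 2)) * y) * t) =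
        pcond x y * t := fun t => by rw [pcond_eq, mul_assoc]
    rw [hp_mul, hp_mul]
    linarith
  rw [hF.idens_eq, hG.idens_eq]
  linarith

lemma MI_perturb_ge (hF : IsDistOn A F) (hr : Measurable r) (hM : ∀ x, |r x| ≤ M)
    (hε : 0 ≤ ε) (hεM : ε * M ≤ 1 / 2) (h0 : ∫ x, r x ∂F = 0) :
    MI F + ε * ∫ x, idens F x * r x ∂F - ε ^ 2 * M ^ 2 ≤ MI (perturb F r ε) := by
  have := hF.1
  have hG := hF.perturb_isDistOn hr hM hε hεM h0
  have := hG.1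
  have hkb := hF.abs_relMean_le hM
  have hkm := (hF.measurable_relMean hr).aestronglyMeasurable (μ := F)
  have hk : Integrable (relMean F r) F := Integrable.of_bound hkm M (ae_of_all _ hkb)
  have hkG : Integrable (relMean F r) (perturb F r ε) :=
    Integrable.of_bound (hF.measurable_relMean hr).aestronglyMeasurable M (ae_of_all _ hkb)
  have hi := hF.integrable_of_continuous hF.continuous_idens
  have hkr : ∫ x, relMean F r x * r x ∂F ≤ M ^ 2 := by
    have h : ‖∫ x, relMean F r x * r x ∂F‖ ≤ M ^ 2 * F.real univ := by
      refine norm_integral_le_of_norm_le_const (ae_of_all _ fun x => ?_)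
      rw [norm_mul, sq]
      exact mul_le_mul (hkb x) (hM x) (norm_nonneg _) ((abs_nonneg _).trans (hM 0))
    rw [probReal_univ, mul_one] at h
    exact (le_abs_self _).trans h
  have hge : ∫ x, (idens F x - ε * relMean F r x) ∂perturb F r ε ≤ MI (perturb F r ε) :=
    integral_mono ((hG.integrable_of_continuous hF.continuous_idens).sub (hkG.const_mul ε))
      (hG.integrable_of_continuous hG.continuous_idens)
      (hF.idens_perturb_ge hr hM hε hεM h0)
  rw [integral_sub (hG.integrable_of_continuous hF.continuous_idens) (hkG.const_mul ε),
    integral_const_mul, integral_perturb hr hM hε hεM hi, integral_perturb hr hM hε hεM hk,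
    hF.integral_relMean hr hM, h0] at hge
  have := mul_le_mul_of_nonneg_left hkr (sq_nonneg ε)
  rw [MI]
  linarith

end IsDistOn

/-- First-order optimality along the directions `r F` that preserve all the constraints. -/
lemma Feas.integral_idens_mul_nonpos {A P B h2 Ereq : ℝ} {F : Measure ℝ}
    (hF : Feas A P B h2 Ereq F) (hmax : ∀ G : Measure ℝ, Feas A P B h2 Ereq G → MI G ≤ MI F)
    {r : ℝ → ℝ} (hr : Measurable r) {M : ℝ} (hM : ∀ x, |r x| ≤ M) (h0 : ∫ x, r x ∂F = 0)
    (h1 : ∫ x, x ^ 2 * r x ∂F = 0) (h3 : ∫ x, EH B h2 x * r x ∂F = 0) :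
    ∫ x, idens F x * r x ∂F ≤ 0 := by
  by_contra! hpos
  have hM0 : 0 ≤ M := (abs_nonneg _).trans (hM 0)
  set J := ∫ x, idens F x * r x ∂F with hJ
  have key : ∀ ε : ℝ, 0 < ε → ε * M ≤ 1 / 2 → J ≤ ε * M ^ 2 := by
    intro ε hε hεM
    have hG : Feas A P B h2 Ereq (perturb F r ε) := by
      refine ⟨hF.1.perturb_isDistOn hr hM hε.le hεM h0, ?_, ?_⟩
      · rw [IsDistOn.integral_perturb hr hM hε.le hεM
          (hF.1.integrable_of_continuous (by fun_prop)), h1, mul_zero, add_zero]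
        exact hF.2.1
      · rw [IsDistOn.integral_perturb hr hM hε.le hεM
          (hF.1.integrable_of_continuous (continuous_EH B h2)), h3, mul_zero, add_zero]
        exact hF.2.2
    have h := (hF.1.MI_perturb_ge hr hM hε.le hεM h0).trans (hmax _ hG)
    rw [← hJ] at h
    have : ε * J ≤ ε * (ε * M ^ 2) := by linarith
    exact le_of_mul_le_mul_left this hε
  have hlim : Tendsto (fun ε : ℝ => ε * M ^ 2) (nhdsWithin 0 (Ioi 0)) (nhds 0) := by
    have : Continuous fun ε : ℝ => ε * M ^ 2 := by fun_prop
    simpa using (this.tendsto 0).mono_left nhdsWithin_le_nhds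
  have hlim2 : Tendsto (fun ε : ℝ => ε * M) (nhdsWithin 0 (Ioi 0)) (nhds 0) := by
    have : Continuous fun ε : ℝ => ε * M := by fun_prop
    simpa using (this.tendsto 0).mono_left nhdsWithin_le_nhds
  obtain ⟨ε, ⟨h, hhalf⟩, hε⟩ := (((hlim.eventually_lt_const hpos).and
    (hlim2.eventually_lt_const one_half_pos)).and self_mem_nhdsWithin).exists
  exact absurd (key ε hε hhalf.le) (not_le.2 h)

/-- Square-integrable functions admit a least-squares fit by three given ones. -/
lemma exists_residual_orthogonal {μ : Measure ℝ} {f u v w : ℝ → ℝ} (hf : MemLp f 2 μ)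
    (hu : MemLp u 2 μ) (hv : MemLp v 2 μ) (hw : MemLp w 2 μ) :
    ∃ a b c : ℝ, ∀ g ∈ ({u, v, w} : Set (ℝ → ℝ)),
      ∫ x, g x * (f x - (a * u x + b * v x + c * w x)) ∂μ = 0 := by
  set V : Submodule ℝ (Lp ℝ 2 μ) := Submodule.span ℝ {hu.toLp, hv.toLp, hw.toLp} with hV
  have : FiniteDimensional ℝ V := FiniteDimensional.span_of_finite ℝ (Set.toFinite _)
  obtain ⟨a, b, c, habc⟩ := Submodule.mem_span_triple.1 (V.starProjection_apply_mem hf.toLp)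
  have horth := V.sub_starProjection_mem_orthogonal hf.toLp
  refine ⟨a, b, c, fun g hg => ?_⟩
  have hg2 : MemLp g 2 μ := by rcases hg with rfl | rfl | rfl <;> assumption
  have hgV : hg2.toLp ∈ V := by
    refine Submodule.subset_span ?_
    rcases hg with rfl | rfl | rfl <;> simp
  have h := horth _ hgV
  rw [← habc, L2.inner_def] at h
  rw [← h]
  refine integral_congr_ae ?_
  have e : (⇑(hf.toLp - (a • hu.toLp + b • hv.toLp + c • hw.toLp)) : ℝ → ℝ) =ᵐ[μ]
      fun x => f x - (a * u x + b * v x + c * w x) := by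
    rw [← MemLp.toLp_const_smul, ← MemLp.toLp_const_smul, ← MemLp.toLp_const_smul,
      ← MemLp.toLp_add, ← MemLp.toLp_add, ← MemLp.toLp_sub]
    exact MemLp.coeFn_toLp _
  filter_upwards [e, hg2.coeFn_toLp] with x hx hgx
  rw [hx, hgx]
  simp [mul_comm]

lemma IsDistOn.msupp_subset {A : ℝ} {F : Measure ℝ} (hF : IsDistOn A F) : msupp F ⊆ Icc 0 A := by
  intro x hx
  by_contra hxA
  exact (hx _ isClosed_Icc.isOpen_compl hxA).ne' hF.2

lemma eq_zero_of_mem_msupp {μ : Measure ℝ} {f : ℝ → ℝ} (hf : Continuous f) (h : f =ᵐ[μ] 0)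
    {x : ℝ} (hx : x ∈ msupp μ) : f x = 0 := by
  by_contra hne
  exact (hx {x | f x ≠ 0} (isOpen_ne_fun hf continuous_const) hne).ne' (ae_iff.1 h)

/-- On the support of an optimal input, the information density is an affine combination of the
two constraint functions. -/
lemma Feas.exists_idens_eq_on_msupp {A P B h2 Ereq : ℝ} {F : Measure ℝ}
    (hF : Feas A P B h2 Ereq F) (hmax : ∀ G : Measure ℝ, Feas A P B h2 Ereq G → MI G ≤ MI F) :
    ∃ a b c : ℝ, ∀ x ∈ msupp F, idens F x = a + b * x ^ 2 + c * EH B h2 x := by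
  have hD := hF.1
  have := hD.1
  have hmem : ∀ {g : ℝ → ℝ}, Continuous g → MemLp g 2 F := fun hg =>
    (memLp_two_iff_integrable_sq hg.aestronglyMeasurable).2
      (hD.integrable_of_continuous (hg.pow 2))
  have hsq : Continuous fun x : ℝ => x ^ 2 := by fun_prop
  obtain ⟨a, b, c, h⟩ := exists_residual_orthogonal (hmem hD.continuous_idens)
    (hmem (continuous_const (y := (1 : ℝ)))) (hmem hsq) (hmem (continuous_EH B h2))
  set ρ : ℝ → ℝ := fun x => idens F x - (a * 1 + b * x ^ 2 + c * EH B h2 x) with hρ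
  have hρc : Continuous ρ := hD.continuous_idens.sub
    ((continuous_const.add (continuous_const.mul hsq)).add
      (continuous_const.mul (continuous_EH B h2)))
  have o1 : ∫ x, 1 * ρ x ∂F = 0 := h (fun _ => 1) (by simp)
  have o2 : ∫ x, x ^ 2 * ρ x ∂F = 0 := h (fun x => x ^ 2) (by simp)
  have o3 : ∫ x, EH B h2 x * ρ x ∂F = 0 := h (EH B h2) (by simp)
  obtain ⟨M, hM⟩ := isCompact_Icc.exists_bound_of_continuousOn (s := Icc (0 : ℝ) A)
    hρc.continuousOn
  set r : ℝ → ℝ := (Icc (0 : ℝ) A).indicator ρ with hrdef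
  have hrM : ∀ x, |r x| ≤ max M 0 := by
    intro x
    by_cases hx : x ∈ Icc (0 : ℝ) A
    · rw [hrdef, indicator_of_mem hx]; exact (hM x hx).trans (le_max_left _ _)
    · rw [hrdef, indicator_of_notMem hx, abs_zero]; exact le_max_right _ _
  have hrρ : ∀ g : ℝ → ℝ, ∫ x, g x * r x ∂F = ∫ x, g x * ρ x ∂F := fun g =>
    integral_congr_ae (hD.ae_mem.mono fun x hx => by simp only [hrdef, indicator_of_mem hx])
  have hle := hF.integral_idens_mul_nonpos hmax (hρc.measurable.indicator measurableSet_Icc) hrM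
    (by simpa only [one_mul] using (hrρ fun _ => 1).trans o1) ((hrρ _).trans o2) ((hrρ _).trans o3)
  rw [hrρ] at hle
  have i0 : Integrable (fun x => ρ x * ρ x) F := hD.integrable_of_continuous (hρc.mul hρc)
  have i1 : Integrable (fun x => a * (1 * ρ x)) F :=
    (hD.integrable_of_continuous (continuous_const.mul hρc)).const_mul a
  have i2 : Integrable (fun x => b * (x ^ 2 * ρ x)) F :=
    (hD.integrable_of_continuous (hsq.mul hρc)).const_mul b
  have i3 : Integrable (fun x => c * (EH B h2 x * ρ x)) F :=
    (hD.integrable_of_continuous ((continuous_EH B h2).mul hρc)).const_mul c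
  have i23 : Integrable (fun x => b * (x ^ 2 * ρ x) + c * (EH B h2 x * ρ x)) F := i2.add i3
  have i123 : Integrable
      (fun x => a * (1 * ρ x) + (b * (x ^ 2 * ρ x) + c * (EH B h2 x * ρ x))) F := i1.add i23
  have hdecomp : ∫ x, idens F x * ρ x ∂F = ∫ x, ρ x * ρ x ∂F := by
    calc ∫ x, idens F x * ρ x ∂F
        = ∫ x, (ρ x * ρ x + (a * (1 * ρ x) + (b * (x ^ 2 * ρ x) + c * (EH B h2 x * ρ x)))) ∂F :=
          integral_congr_ae (ae_of_all _ fun x => by simp only [hρ]; ring)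
      _ = ∫ x, ρ x * ρ x ∂F := by
          rw [integral_add i0 i123, integral_add i1 i23,
            integral_add i2 i3, integral_const_mul a, integral_const_mul b, integral_const_mul c,
            o1, o2, o3]
          ring
  rw [hdecomp] at hle
  have hzero := (integral_eq_zero_iff_of_nonneg (fun x => mul_self_nonneg (ρ x)) i0).1
    (le_antisymm hle (integral_nonneg fun x => mul_self_nonneg (ρ x)))
  refine ⟨a, b, c, fun x hx => ?_⟩
  have := mul_self_eq_zero.1 (eq_zero_of_mem_msupp (hρc.mul hρc) hzero hx)
  simp only [hρ] at this
  linarith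

/-- An analytic function on the positive half-line vanishing at `1 / (1 + x²)` for infinitely many
`x ∈ [0, A]` is zero. -/
lemma eqOn_zero_of_infinite {A : ℝ} {f : ℝ → ℝ} (hf : AnalyticOnNhd ℝ f (Ioi 0)) {S : Set ℝ}
    (hS : S.Infinite) (hSA : S ⊆ Icc 0 A) (h : ∀ x ∈ S, f (1 / (1 + x ^ 2)) = 0) :
    EqOn f 0 (Ioi 0) := by
  set φ : ℝ → ℝ := fun x => 1 / (1 + x ^ 2) with hφ
  have hx : ∀ x : ℝ, 1 + x ^ 2 ≠ 0 := fun x => by positivity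
  have hφc : Continuous φ := by fun_prop (disch := exact hx)
  have hinj : InjOn φ (Icc 0 A) := by
    intro x hxA y hyA hxy
    have h1 : 1 + x ^ 2 = 1 + y ^ 2 := by simpa [hφ] using hxy
    exact (pow_left_inj₀ hxA.1 hyA.1 two_ne_zero).1 (by linarith)
  obtain ⟨s, hsK, hs⟩ := (hS.image (hinj.mono hSA)).exists_accPt_of_subset_isCompact
    (isCompact_Icc.image hφc) (image_mono hSA)
  obtain ⟨t, -, rfl⟩ := hsK
  refine hf.eqOn_zero_of_preconnected_of_frequently_eq_zero isPreconnected_Ioi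
    (z₀ := φ t) (by simp only [hφ, mem_Ioi]; positivity) ?_
  refine (accPt_iff_frequently_nhdsNE.1 hs).mono ?_
  rintro _ ⟨x, hxS, rfl⟩
  exact h x hxS

/-- A quadratic with positive leading coefficient is not dominated by an affine function. -/
lemma exists_affine_lt_mul_sq {q : ℝ} (hq : 0 < q) (α β : ℝ) :
    ∃ t : ℝ, 0 < t ∧ α + β * t < q * t ^ 2 := by
  refine ⟨(|α| + |β|) / q + 1, by positivity, ?_⟩
  set t := (|α| + |β|) / q + 1 with ht
  have h1 : q * t = |α| + |β| + q := by rw [ht]; field_simp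
  have ht1 : 1 ≤ t := by rw [ht]; linarith [show 0 ≤ (|α| + |β|) / q by positivity]
  have h2 : q * t ^ 2 = (|α| + |β| + q) * t := by rw [← h1]; ring
  nlinarith [le_abs_self α, abs_nonneg α,
    mul_le_mul_of_nonneg_right (le_abs_self β) (by linarith : (0 : ℝ) ≤ t)]

/-- No function of the form `log s - 1 + s L(s)`, with `0 ≤ L(s) ≤ s⁻² + D s⁻¹`, is an affine
combination of `1 / s - 1` and `besselSeries (k (1 / s - 1))` on the positive half-line. -/
lemma not_forall_log_add_laplace_eq {L : ℝ → ℝ} {D k : ℝ} (hk : 0 < k) (hL0 : ∀ s, 0 ≤ L s)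
    (hL : ∀ s, 0 < s → L s ≤ (1 / s) ^ 2 + D * (1 / s)) (a b c : ℝ) :
    ¬ ∀ s : ℝ, 0 < s → Real.log s - 1 + s * L s =
      a + b * (1 / s - 1) + c * besselSeries (k * (1 / s - 1)) := by
  intro h
  have hc : c = 0 := by
    by_contra hc
    obtain ⟨t, ht, hlt⟩ := exists_affine_lt_mul_sq
      (show 0 < |c| * (k ^ 2 / 4) by positivity) (|a| + 1 + |D| + 1) (|b| + 2)
    have h1t : (0 : ℝ) < 1 + t := by linarith
    have hs : 0 < (1 + t)⁻¹ := by positivity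
    have he := h _ hs
    have hu := hL _ hs
    have hn := hL0 (1 + t)⁻¹
    rw [Real.log_inv, one_div, inv_inv, add_sub_cancel_left] at he
    rw [one_div, inv_inv] at hu
    have hsL : (1 + t)⁻¹ * L (1 + t)⁻¹ ≤ 1 + t + D := by
      calc (1 + t)⁻¹ * L (1 + t)⁻¹ ≤ (1 + t)⁻¹ * ((1 + t) ^ 2 + D * (1 + t)) := by gcongr
        _ = 1 + t + D := by field_simp
    have hsL0 : 0 ≤ (1 + t)⁻¹ * L (1 + t)⁻¹ := by positivity
    have hlog0 : 0 ≤ Real.log (1 + t) := Real.log_nonneg (by linarith)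
    have hlog1 : Real.log (1 + t) ≤ t := by
      linarith [Real.log_le_sub_one_of_pos h1t]
    have hb := sq_div_four_le_besselSeries (u := k * t) (by positivity)
    have habs : |c| * besselSeries (k * t) ≤ |a| + |b| * t + 1 + |D| + 1 + 2 * t := by
      have hbn : 0 ≤ besselSeries (k * t) := le_trans (by positivity) hb
      rw [← abs_of_nonneg hbn, ← abs_mul, abs_le]
      have hbt : |b * t| = |b| * t := by rw [abs_mul, abs_of_pos ht]
      have := neg_abs_le (b * t)
      have := le_abs_self (b * t)
      have := neg_abs_le a
      have := le_abs_self a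
      have := le_abs_self D
      have := abs_nonneg D
      constructor <;> linarith
    have := mul_le_mul_of_nonneg_left hb (abs_nonneg c)
    nlinarith
  subst hc
  set T := |a| + |b| + 2 with hT
  have hTpos : 0 < T := by positivity
  have he := h (Real.exp T) (Real.exp_pos T)
  have hsL0 : 0 ≤ Real.exp T * L (Real.exp T) := mul_nonneg (Real.exp_pos T).le (hL0 _)
  rw [Real.log_exp, zero_mul, add_zero] at he
  have hinv0 : 0 < 1 / Real.exp T := by positivity
  have hinv1 : 1 / Real.exp T ≤ 1 := by
    rw [div_le_one (Real.exp_pos T)]; exact Real.one_le_exp hTpos.le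
  have hbb : b * (1 / Real.exp T - 1) ≤ |b| := by
    refine (le_abs_self _).trans ?_
    rw [abs_mul]
    refine mul_le_of_le_one_right (abs_nonneg b) (abs_le.2 ⟨by linarith, by linarith⟩)
  linarith [le_abs_self a]

/-- If `Ω` is nonempty and a Slater point exists, then any
capacity-achieving input distribution `F*` (a maximizer of `I` over `Ω`) is discrete
with finitely many mass points: its topological support is a finite subset of `[0, A]`. -/
theorem stmt5 (A P B h2 Ereq : ℝ) (hA : 0 < A) (hP : 0 < P) (hB : 0 < B) (hh2 : 0 < h2)
    (hne : ∃ F : Measure ℝ, Feas A P B h2 Ereq F)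
    (hslater : ∃ x₁ ∈ Set.Icc (0 : ℝ) A, x₁ ^ 2 < P ∧ Ereq < EH B h2 x₁)
    (Fstar : Measure ℝ) (hFstar : Feas A P B h2 Ereq Fstar)
    (hmax : ∀ F : Measure ℝ, Feas A P B h2 Ereq F → MI F ≤ MI Fstar) :
    (msupp Fstar).Finite ∧ msupp Fstar ⊆ Set.Icc (0 : ℝ) A := by
  have hD := hFstar.1
  refine ⟨?_, hD.msupp_subset⟩
  by_contra hinf
  obtain ⟨a, b, c, hsupp⟩ := hFstar.exists_idens_eq_on_msupp hmax
  set k := B ^ 2 * h2 ^ 2 / 2 with hk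
  have hbes : AnalyticOnNhd ℝ (fun s : ℝ => besselSeries (k * (1 / s - 1))) (Ioi 0) :=
    fun s hs => (analyticOnNhd_besselSeries _ (mem_univ _)).comp
      (analyticAt_const.mul ((analyticAt_const.div analyticAt_id (ne_of_gt hs)).sub
        analyticAt_const))
  have hf : AnalyticOnNhd ℝ (fun s : ℝ => Real.log s - 1 + s * laplaceOut Fstar s -
      (a + b * (1 / s - 1) + c * besselSeries (k * (1 / s - 1)))) (Ioi 0) := fun s hs =>
    (((analyticAt_log hs).sub analyticAt_const).add
      (analyticAt_id.mul (hD.analyticOnNhd_laplaceOut s hs))).sub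
      ((analyticAt_const.add (analyticAt_const.mul
        ((analyticAt_const.div analyticAt_id (ne_of_gt hs)).sub analyticAt_const))).add
        (analyticAt_const.mul (hbes s hs)))
  have hzero := eqOn_zero_of_infinite hf hinf hD.msupp_subset fun x hx => by
    have h := hsupp x hx
    rw [hD.idens_eq, EH_eq_besselSeries, ← hk] at h
    rw [one_div_one_div, add_sub_cancel_left, ← h, one_div, Real.log_inv]
    ring
  exact not_forall_log_add_laplace_eq (by positivity) hD.laplaceOut_nonneg
    (fun s hs => hD.laplaceOut_le hs) a b c fun s hs => sub_eq_zero.1 (hzero hs)
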